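/- Let R = K[u₁,u₂,x₁,x₂,x₃] and let a_j^{(i)} ∈ K[u₁,u₂] for i = 1,2 and j = 1,2,3. Let S be the set of all f ∈ R satisfying the two linear partial differential equations Σ_{j=1}^{3} a_j^{(i)}·(∂f/∂xⱼ) = 0 for i = 1,2. Let Δ be the 3×3 determinant of the matrix with rows (a₁^{(1)},a₂^{(1)},a₃^{(1)}), (a₁^{(2)},a₂^{(2)},a₃^{(2)}), (x₁,x₂,x₃). Assume the ideal of K[u₁,u₂] generated by the three 2×2 minors of the 2×3 matrix (a_j^{(i)}) has height two. Then S = K[u₁,u₂,Δ], the K-subalgebra of R generated by u₁, u₂ and Δ. -/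

import Mathlib

open MvPolynomial

/-- The height of an ideal: the infimum of the heights of the prime ideals containing it. -/
noncomputable def idealHeight {R : Type*} [CommRing R] (I : Ideal R) : ℕ∞ :=
  ⨅ (p : PrimeSpectrum R) (_ : I ≤ p.asIdeal), Order.height p

/-- The canonical inclusion `K[u₁,u₂] → K[u₁,u₂,x₁,x₂,x₃]`
(the variables `u₁,u₂` are the first two variables of the quinary polynomial ring). -/
noncomputable def inclU {K : Type*} [CommSemiring K] :
    MvPolynomial (Fin 2) K →ₐ[K] MvPolynomial (Fin 5) K :=
  rename (Fin.castLE (by norm_num))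

section MvPolynomialFacts

variable {σ R : Type*} [CommRing R]

theorem totalDegree_pderiv_lt_of_ne_zero {i : σ} {p : MvPolynomial σ R} (h : pderiv i p ≠ 0) :
    (pderiv i p).totalDegree < p.totalDegree := by
  have hlt : ∀ m ∈ (pderiv i p).support, (m.sum fun _ e => e) < p.totalDegree := by
    intro m hm
    rw [mem_support_iff, coeff_pderiv] at hm
    have hmem : m + Finsupp.single i 1 ∈ p.support :=
      mem_support_iff.mpr fun h0 => hm (by rw [h0, zero_mul])
    have hle := le_totalDegree hmem
    rw [Finsupp.sum_add_index' (fun _ => rfl) (fun _ _ _ => rfl),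
      Finsupp.sum_single_index rfl] at hle
    omega
  obtain ⟨m, hm⟩ := support_nonempty.mpr h
  exact (Finset.sup_lt_iff (lt_of_le_of_lt (Nat.zero_le _) (hlt m hm))).mpr hlt

theorem notMem_vars_of_pderiv_eq_zero [IsDomain R] [CharZero R] {i : σ} {p : MvPolynomial σ R}
    (h : pderiv i p = 0) : i ∉ p.vars := by
  intro hi
  obtain ⟨d, hd, hid⟩ := (mem_vars_iff_mem_support i).mp hi
  have hsplit : d - Finsupp.single i 1 + Finsupp.single i 1 = d :=
    tsub_add_cancel_of_le (Finsupp.single_le_iff.mpr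
      (Nat.one_le_iff_ne_zero.mpr (Finsupp.mem_support_iff.mp hid)))
  have hcoeff := coeff_pderiv (i := i) p (d - Finsupp.single i 1)
  rw [h, coeff_zero, hsplit] at hcoeff
  exact mul_ne_zero (mem_support_iff.mp hd) (Nat.cast_add_one_ne_zero _) hcoeff.symm

theorem pderiv_pderiv_comm (i j : σ) (p : MvPolynomial σ R) :
    pderiv i (pderiv j p) = pderiv j (pderiv i p) := by
  classical
  have h : ⁅(pderiv i : Derivation R (MvPolynomial σ R) (MvPolynomial σ R)),
      (pderiv j : Derivation R (MvPolynomial σ R) (MvPolynomial σ R))⁆ = 0 := by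
    refine derivation_ext fun k => ?_
    rw [Derivation.commutator_apply, pderiv_X, pderiv_X, Pi.single_apply, Pi.single_apply]
    split_ifs <;> simp
  rw [← sub_eq_zero, ← Derivation.commutator_apply, h, Derivation.zero_apply]

end MvPolynomialFacts

/-- In a unique factorization domain, a vector proportional to a vector `c` without common
factors is a multiple of `c`. -/
theorem exists_eq_mul_of_proportional {R ι : Type*} [CommRing R] [IsDomain R]
    [UniqueFactorizationMonoid R] [Fintype ι] {c v : ι → R}
    (hc : ∀ d, (∀ i, d ∣ c i) → IsUnit d) (hv : ∀ i j, c i * v j = c j * v i) :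
    ∃ g, ∀ i, v i = c i * g := by
  classical
  obtain ⟨k, hk⟩ : ∃ k, c k ≠ 0 := by
    by_contra! h
    exact not_isUnit_zero (hc 0 fun i => by rw [h i])
  let _ : StrongNormalizationMonoid R := UniqueFactorizationMonoid.strongNormalizationMonoid
  let _ : StrongNormalizedGCDMonoid R := UniqueFactorizationMonoid.toStrongNormalizedGCDMonoid R
  have hunit : IsUnit (Finset.univ.gcd c) := hc _ fun i => Finset.gcd_dvd (Finset.mem_univ i)
  have hdvd : c k ∣ normalize (v k) * Finset.univ.gcd c := by
    rw [← Finset.gcd_mul_left]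
    exact Finset.dvd_gcd fun i _ => ⟨v i, by rw [mul_comm, hv i k]⟩
  obtain ⟨g, hg⟩ := dvd_normalize_iff.mp (hunit.dvd_mul_right.mp hdvd)
  refine ⟨g, fun i => mul_left_cancel₀ hk ?_⟩
  rw [hv k i, hg]
  ring

theorem isUnit_of_dvd_of_one_lt_idealHeight {R : Type*} [CommRing R] [IsNoetherianRing R]
    {s : Set R} (hs : 1 < idealHeight (Ideal.span s)) {d : R} (hd : ∀ x ∈ s, d ∣ x) :
    IsUnit d := by
  by_contra hunit
  have htop : Ideal.span {d} ≠ ⊤ := fun h => hunit (Ideal.span_singleton_eq_top.mp h)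
  obtain ⟨P, hP⟩ := Ideal.nonempty_minimalPrimes htop
  have hprime : P.IsPrime := hP.1.1
  have hle : Ideal.span s ≤ P := (Ideal.span_le.mpr fun x hx =>
    Ideal.mem_span_singleton.mpr (hd x hx)).trans hP.1.2
  have hheight := Ideal.height_le_one_of_isPrincipal_of_mem_minimalPrimes _ P hP
  have hinf : idealHeight (Ideal.span s) ≤ Order.height (⟨P, hprime⟩ : PrimeSpectrum R) :=
    iInf₂_le (⟨P, hprime⟩ : PrimeSpectrum R) hle
  rw [← PrimeSpectrum.height_eq_orderHeight] at hinf
  exact absurd (hs.trans_le (hinf.trans hheight)) (lt_irrefl _)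

section InclU

variable {K : Type*} [Field K]

/-- The index in `Fin 5` of the variable `x_j`. -/
def xIndex (j : Fin 3) : Fin 5 := j.addNat 2

theorem inclU_injective :
    Function.Injective (inclU : MvPolynomial (Fin 2) K →ₐ[K] MvPolynomial (Fin 5) K) :=
  rename_injective _ (Fin.castLE_injective _)

theorem xIndex_notMem_vars_inclU (b : MvPolynomial (Fin 2) K) (j : Fin 3) :
    xIndex j ∉ (inclU b).vars := by
  classical
  intro h
  obtain ⟨i, -, hi⟩ := Finset.mem_image.mp (vars_rename _ b h)
  have := congrArg Fin.val hi
  simp only [xIndex, Fin.val_castLE, Fin.val_addNat] at this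
  omega

@[simp]
theorem pderiv_xIndex_inclU (b : MvPolynomial (Fin 2) K) (j : Fin 3) :
    pderiv (xIndex j) (inclU b) = 0 :=
  pderiv_eq_zero_of_notMem_vars (xIndex_notMem_vars_inclU b j)

theorem exists_inclU_eq {f : MvPolynomial (Fin 5) K} (hf : ∀ j, xIndex j ∉ f.vars) :
    ∃ b, inclU b = f := by
  refine exists_rename_eq_of_vars_subset_range f _ (Fin.castLE_injective _) fun i hi => ?_
  by_cases h : (i : ℕ) < 2
  · exact ⟨⟨i, h⟩, rfl⟩
  · refine absurd hi ?_
    have hi' : xIndex ⟨(i : ℕ) - 2, by omega⟩ = i :=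
      Fin.ext (by simp only [xIndex, Fin.val_addNat]; omega)
    exact hi' ▸ hf ⟨(i : ℕ) - 2, by omega⟩

theorem exists_inclU_eq_of_dvd {b : MvPolynomial (Fin 2) K} (hb : b ≠ 0)
    {d : MvPolynomial (Fin 5) K} (hd : d ∣ inclU b) : ∃ b', inclU b' = d := by
  refine exists_inclU_eq fun j hj => xIndex_notMem_vars_inclU b j ?_
  obtain ⟨e, he⟩ := hd
  have hne : d * e ≠ 0 := he ▸ (map_ne_zero_iff _ inclU_injective).mpr hb
  rw [mem_vars_iff_degreeOf_ne_zero] at hj ⊢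
  rw [he, degreeOf_mul_eq (left_ne_zero_of_mul hne) (right_ne_zero_of_mul hne)]
  omega

theorem dvd_of_inclU_dvd_inclU {b b' : MvPolynomial (Fin 2) K} (h : inclU b ∣ inclU b') :
    b ∣ b' := by
  have h' := map_dvd (killCompl (R := K) (Fin.castLE_injective (by norm_num : 2 ≤ 5))) h
  rwa [inclU, killCompl_rename_app, killCompl_rename_app] at h'

theorem isUnit_of_forall_dvd_inclU {ι : Type*} {c : ι → MvPolynomial (Fin 2) K}
    (hc : ∀ d, (∀ j, d ∣ c j) → IsUnit d) {d : MvPolynomial (Fin 5) K}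
    (hd : ∀ j, d ∣ inclU (c j)) : IsUnit d := by
  obtain ⟨k, hk⟩ : ∃ k, c k ≠ 0 := by
    by_contra! h
    exact not_isUnit_zero (hc 0 fun i => by rw [h i])
  obtain ⟨b, rfl⟩ := exists_inclU_eq_of_dvd hk (hd k)
  exact (hc b fun j => dvd_of_inclU_dvd_inclU (hd j)).map inclU

theorem inclU_mem_adjoin (b : MvPolynomial (Fin 2) K) {s : Set (MvPolynomial (Fin 5) K)}
    (h0 : X 0 ∈ s) (h1 : X 1 ∈ s) : inclU b ∈ Algebra.adjoin K s := by
  induction b using MvPolynomial.induction_on with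
  | C r => simpa [inclU] using (Algebra.adjoin K s).algebraMap_mem r
  | add p q hp hq => rw [map_add]; exact add_mem hp hq
  | mul_X p i hp =>
    rw [map_mul]
    refine mul_mem hp (Algebra.subset_adjoin ?_)
    fin_cases i
    · simpa [inclU] using h0
    · simpa [inclU] using h1

theorem exists_antiderivative_eval₂ [CharZero K] {c : Fin 3 → MvPolynomial (Fin 2) K}
    {D : MvPolynomial (Fin 5) K} (hD : ∀ j, pderiv (xIndex j) D = inclU (c j))
    (P : Polynomial (MvPolynomial (Fin 2) K)) :
    ∃ Q : Polynomial (MvPolynomial (Fin 2) K), ∀ j,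
      pderiv (xIndex j) (Q.eval₂ inclU.toRingHom D) =
        inclU (c j) * P.eval₂ inclU.toRingHom D := by
  induction P using Polynomial.induction_on' with
  | add P₁ P₂ h₁ h₂ =>
    obtain ⟨Q₁, h₁⟩ := h₁
    obtain ⟨Q₂, h₂⟩ := h₂
    refine ⟨Q₁ + Q₂, fun j => ?_⟩
    rw [Polynomial.eval₂_add, Polynomial.eval₂_add, map_add, h₁, h₂, mul_add]
  | monomial n b =>
    refine ⟨Polynomial.monomial (n + 1) (C ((n + 1 : K)⁻¹) * b), fun j => ?_⟩
    have hn : (C ((n + 1 : K)⁻¹) : MvPolynomial (Fin 5) K) * ((n : MvPolynomial (Fin 5) K) + 1)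
        = 1 := by
      rw [← map_natCast (C : K →+* MvPolynomial (Fin 5) K) n, ← C_1, ← C_add, ← C_mul, C_1,
        inv_mul_cancel₀ (Nat.cast_add_one_ne_zero n), C_1]
    have hC : inclU (C ((n + 1 : K)⁻¹)) = (C ((n + 1 : K)⁻¹) : MvPolynomial (Fin 5) K) :=
      rename_C _ _
    simp only [Polynomial.eval₂_monomial, AlgHom.toRingHom_eq_coe, RingHom.coe_coe,
      pderiv_mul, pderiv_xIndex_inclU, pderiv_pow, hD, map_mul, hC]
    simp only [pderiv_C, Nat.cast_add, Nat.cast_one, Nat.add_sub_cancel]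
    linear_combination inclU b * D ^ n * inclU (c j) * hn

/-- If the `x`-gradient of `f` is proportional to the `x`-gradient `c` of `D`, and the entries
of `c` depend only on `u₁,u₂` and have no common factor, then `f` is a polynomial in `D` with
coefficients in `K[u₁,u₂]`. -/
theorem exists_eval₂_eq_of_pderiv_proportional [CharZero K]
    {c : Fin 3 → MvPolynomial (Fin 2) K} (hc : ∀ d, (∀ j, d ∣ c j) → IsUnit d)
    {D : MvPolynomial (Fin 5) K} (hD : ∀ j, pderiv (xIndex j) D = inclU (c j))
    (f : MvPolynomial (Fin 5) K)
    (hf : ∀ i j, inclU (c i) * pderiv (xIndex j) f = inclU (c j) * pderiv (xIndex i) f) :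
    ∃ P : Polynomial (MvPolynomial (Fin 2) K), P.eval₂ inclU.toRingHom D = f := by
  induction hN : f.totalDegree using Nat.strong_induction_on generalizing f with
  | _ N ih =>
  have hconst : ∀ p : MvPolynomial (Fin 5) K, (∀ j, pderiv (xIndex j) p = 0) →
      ∃ b, inclU b = p :=
    fun p hp => exists_inclU_eq fun j => notMem_vars_of_pderiv_eq_zero (hp j)
  by_cases h0 : ∀ j, pderiv (xIndex j) f = 0
  · obtain ⟨b, hb⟩ := hconst f h0
    exact ⟨Polynomial.C b, by simpa using hb⟩
  push Not at h0
  obtain ⟨k, hk⟩ := h0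
  obtain ⟨g, hg⟩ := exists_eq_mul_of_proportional
    (fun d => isUnit_of_forall_dvd_inclU hc) hf
  have hprod : inclU (c k) * g ≠ 0 := hg k ▸ hk
  have hck := left_ne_zero_of_mul hprod
  have hdeg : g.totalDegree < N := by
    have hlt := totalDegree_pderiv_lt_of_ne_zero hk
    rw [hg k, totalDegree_mul_of_isDomain hck (right_ne_zero_of_mul hprod), hN] at hlt
    omega
  have hgf : ∀ i j, inclU (c i) * pderiv (xIndex j) g = inclU (c j) * pderiv (xIndex i) g := by
    have hmix : ∀ i j, inclU (c i) * pderiv (xIndex j) g =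
        pderiv (xIndex j) (pderiv (xIndex i) f) := by
      intro i j
      rw [hg i, pderiv_mul, pderiv_xIndex_inclU, zero_mul, zero_add]
    intro i j
    rw [hmix, hmix, pderiv_pderiv_comm]
  obtain ⟨P, hP⟩ := ih _ hdeg g hgf rfl
  obtain ⟨Q, hQ⟩ := exists_antiderivative_eval₂ hD P
  obtain ⟨b, hb⟩ := hconst (f - Q.eval₂ inclU.toRingHom D) fun j => by
    rw [map_sub, hQ, hP, hg, sub_self]
  refine ⟨Polynomial.C b + Q, ?_⟩
  rw [Polynomial.eval₂_add, Polynomial.eval₂_C]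
  exact (eq_sub_iff_add_eq.mp hb)

end InclU

/-- Let `R = K[u₁,u₂,x₁,x₂,x₃]` and let `a_j^{(i)} ∈ K[u₁,u₂]` be such that the ideal of
`K[u₁,u₂]` generated by the three `2 × 2` minors of the matrix `(a_j^{(i)})` has height two.
Then the set of solutions `f ∈ R` of the two differential equations
`∑_j a_j^{(i)} ∂f/∂xⱼ = 0` (`i = 1,2`) is exactly the subalgebra `K[u₁,u₂,Δ]`, where
`Δ` is the determinant of the `3 × 3` matrix with rows `(a^{(1)}), (a^{(2)}), (x₁,x₂,x₃)`. -/
theorem solutions_eq_adjoin_delta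
    {K : Type*} [Field K] [IsAlgClosed K] [CharZero K]
    (a : Fin 2 → Fin 3 → MvPolynomial (Fin 2) K)
    (hht : idealHeight (Ideal.span
      {a 0 0 * a 1 1 - a 0 1 * a 1 0,
       a 0 0 * a 1 2 - a 0 2 * a 1 0,
       a 0 1 * a 1 2 - a 0 2 * a 1 1}) = 2)
    (f : MvPolynomial (Fin 5) K) :
    (∀ i : Fin 2, ∑ j : Fin 3,
        inclU (a i j) * pderiv (⟨(j : ℕ) + 2, by omega⟩ : Fin 5) f = 0) ↔
      f ∈ Algebra.adjoin K
        ({X 0, X 1,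
          (!![inclU (a 0 0), inclU (a 0 1), inclU (a 0 2);
              inclU (a 1 0), inclU (a 1 1), inclU (a 1 2);
              X 2, X 3, X 4] : Matrix (Fin 3) (Fin 3) (MvPolynomial (Fin 5) K)).det} :
          Set (MvPolynomial (Fin 5) K)) := by
  set D := (!![inclU (a 0 0), inclU (a 0 1), inclU (a 0 2);
    inclU (a 1 0), inclU (a 1 1), inclU (a 1 2);
    X 2, X 3, X 4] : Matrix (Fin 3) (Fin 3) (MvPolynomial (Fin 5) K)).det with hDdef
  let c : Fin 3 → MvPolynomial (Fin 2) K :=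
    ![a 0 1 * a 1 2 - a 0 2 * a 1 1, -(a 0 0 * a 1 2 - a 0 2 * a 1 0),
      a 0 0 * a 1 1 - a 0 1 * a 1 0]
  have hDsum : D = ∑ j, inclU (c j) * X (xIndex j) := by
    simp only [hDdef, Matrix.det_fin_three, Fin.sum_univ_three, c, xIndex]
    simp
    ring
  have hD : ∀ j, pderiv (xIndex j) D = inclU (c j) := by
    intro j
    have hX : ∀ i : Fin 3, pderiv (xIndex j) (X (xIndex i) : MvPolynomial (Fin 5) K) =
        if i = j then 1 else 0 := by
      intro i
      simp [pderiv_X, Pi.single_apply, xIndex, Fin.ext_iff, eq_comm]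
    simp [hDsum, hX]
  have hac : ∀ i, ∑ j, a i j * c j = 0 := by
    intro i
    fin_cases i <;> simp [Fin.sum_univ_three, c] <;> ring
  have hc : ∀ d, (∀ j, d ∣ c j) → IsUnit d := by
    intro d hd
    refine isUnit_of_dvd_of_one_lt_idealHeight (by rw [hht]; norm_num) fun x hx => ?_
    rcases hx with rfl | rfl | rfl
    · exact hd 2
    · exact (dvd_neg.mp (hd 1))
    · exact hd 0
  constructor
  · intro hf
    have hcross : ∀ i j,
        inclU (c i) * pderiv (xIndex j) f = inclU (c j) * pderiv (xIndex i) f := by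
      have h0 : ∑ j, inclU (a 0 j) * pderiv (xIndex j) f = 0 := hf 0
      have h1 : ∑ j, inclU (a 1 j) * pderiv (xIndex j) f = 0 := hf 1
      rw [Fin.sum_univ_three] at h0 h1
      have h01 : inclU (c 0) * pderiv (xIndex 1) f = inclU (c 1) * pderiv (xIndex 0) f := by
        simp only [c, Matrix.cons_val, map_sub, map_mul, map_neg]
        linear_combination inclU (a 1 2) * h0 - inclU (a 0 2) * h1
      have h02 : inclU (c 0) * pderiv (xIndex 2) f = inclU (c 2) * pderiv (xIndex 0) f := by
        simp only [c, Matrix.cons_val, map_sub, map_mul]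
        linear_combination inclU (a 0 1) * h1 - inclU (a 1 1) * h0
      have h12 : inclU (c 1) * pderiv (xIndex 2) f = inclU (c 2) * pderiv (xIndex 1) f := by
        simp only [c, Matrix.cons_val, map_sub, map_mul, map_neg]
        linear_combination inclU (a 1 0) * h0 - inclU (a 0 0) * h1
      intro i j
      fin_cases i <;> fin_cases j
      exacts [rfl, h01, h02, h01.symm, rfl, h12, h02.symm, h12.symm, rfl]
    obtain ⟨P, rfl⟩ := exists_eval₂_eq_of_pderiv_proportional hc hD f hcross
    rw [Polynomial.eval₂_eq_sum]
    exact sum_mem fun n _ => mul_mem (inclU_mem_adjoin _ (by simp) (by simp))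
      (pow_mem (Algebra.subset_adjoin (by simp)) n)
  · intro hf i
    change ∑ j, inclU (a i j) * pderiv (xIndex j) f = 0
    induction hf using Algebra.adjoin_induction with
    | mem x hx =>
      have hX : ∀ k : Fin 2, ∑ j, inclU (a i j) * pderiv (xIndex j) (inclU (X k)) = 0 := by
        simp
      rcases hx with rfl | rfl | rfl
      · simpa [inclU] using hX 0
      · simpa [inclU] using hX 1
      · simp only [hD, ← map_mul, ← map_sum, hac, map_zero]
    | algebraMap r => simp [algebraMap_eq]
    | add x y _ _ hx hy => simp only [map_add, mul_add, Finset.sum_add_distrib, hx, hy, add_zero]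
    | mul x y _ _ hx hy =>
      simp only [Fin.sum_univ_three, pderiv_mul] at hx hy ⊢
      linear_combination y * hx + x * hy
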